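/- If 1 ≤ a ≤ b then I_2(X;a,b) ≤ 2b · p^{4(b−a)} · I_2(X;2b−a,b). -/

import Mathlib

/-- `Icount p X m a b ξ η` is the number of 12-tuples `(x₁,…,x₆,x₇,…,x₁₂)` of positive
integers `≤ X` (encoded as a pair of 6-tuples) satisfying
`x₁ʲ+⋯+x₆ʲ = x₇ʲ+⋯+x₁₂ʲ` for `j = 1,2,3`, with `xᵢ ≡ ξ (mod pᵃ)` for
`1 ≤ i ≤ m` and `7 ≤ i ≤ 6+m`, and `xᵢ ≡ η (mod pᵇ)` for the remaining indices. -/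
noncomputable def Icount (p : ℕ) (X : ℝ) (m a b : ℕ) (ξ η : ℤ) : ℕ :=
  Nat.card {xy : (Fin 6 → ℕ) × (Fin 6 → ℕ) //
    (∀ i, 1 ≤ xy.1 i ∧ (xy.1 i : ℝ) ≤ X) ∧
    (∀ i, 1 ≤ xy.2 i ∧ (xy.2 i : ℝ) ≤ X) ∧
    (∀ j ∈ Finset.Icc 1 3, ∑ i, xy.1 i ^ j = ∑ i, xy.2 i ^ j) ∧
    (∀ i : Fin 6, if (i : ℕ) < m then (xy.1 i : ℤ) ≡ ξ [ZMOD (p : ℤ) ^ a]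
      else (xy.1 i : ℤ) ≡ η [ZMOD (p : ℤ) ^ b]) ∧
    (∀ i : Fin 6, if (i : ℕ) < m then (xy.2 i : ℤ) ≡ ξ [ZMOD (p : ℤ) ^ a]
      else (xy.2 i : ℤ) ≡ η [ZMOD (p : ℤ) ^ b])}

/-- `Imax p X m a b` : for `m = 0`, the maximum of `Icount p X 0 a b ξ η` over residues
`η mod pᵇ` (it is independent of `ξ`); for `1 ≤ m ≤ 5`, the maximum of
`Icount p X m a b ξ η` over residues `ξ mod pᵃ`, `η mod pᵇ` with `ξ ≢ η (mod p)`. -/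
noncomputable def Imax (p : ℕ) (X : ℝ) (m a b : ℕ) : ℕ :=
  if m = 0 then sSup {n : ℕ | ∃ η : ℤ, n = Icount p X 0 a b 0 η}
  else sSup {n : ℕ | ∃ ξ η : ℤ, ¬ ξ ≡ η [ZMOD (p : ℤ)] ∧ n = Icount p X m a b ξ η}

open Finset in
theorem card_coincidences_eq_sum {α β G : Type*} [DecidableEq G] {s : Finset α} (t : Finset β)
    {f : α → G} (g : β → G) {K : Finset G} (hK : ∀ x ∈ s, f x ∈ K) :
    #{z ∈ s ×ˢ t | f z.1 = g z.2} = ∑ h ∈ K, #{x ∈ s | f x = h} * #{y ∈ t | g y = h} := by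
  rw [card_eq_sum_card_fiberwise (f := fun z => f z.1) (t := K)]
  · refine sum_congr rfl fun h _ => ?_
    rw [← card_product]
    congr 1
    ext ⟨x, y⟩
    simp only [mem_filter, mem_product]
    constructor
    · rintro ⟨⟨⟨hx, hy⟩, h1⟩, rfl⟩
      exact ⟨⟨hx, rfl⟩, hy, h1.symm⟩
    · rintro ⟨⟨hx, rfl⟩, hy, h1⟩
      exact ⟨⟨⟨hx, hy⟩, h1.symm⟩, rfl⟩
  · intro z hz
    simp only [coe_filter, mem_product, Set.mem_ofPred_eq] at hz
    exact hK _ hz.1.1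

open Finset in
/-- The number of coincidences between two families is at most the mean of their
numbers of self-coincidences. -/
theorem two_mul_card_coincidences_le {α β G : Type*} [DecidableEq G] (s : Finset α)
    (t : Finset β) (f : α → G) (g : β → G) :
    2 * #{z ∈ s ×ˢ t | f z.1 = g z.2} ≤
      #{z ∈ s ×ˢ s | f z.1 = f z.2} + #{z ∈ t ×ˢ t | g z.1 = g z.2} := by
  have hs : ∀ x ∈ s, f x ∈ s.image f ∪ t.image g := fun x hx =>
    mem_union_left _ (mem_image_of_mem f hx)
  have ht : ∀ y ∈ t, g y ∈ s.image f ∪ t.image g := fun y hy =>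
    mem_union_right _ (mem_image_of_mem g hy)
  rw [card_coincidences_eq_sum t g hs, card_coincidences_eq_sum s f hs,
    card_coincidences_eq_sum t g ht, mul_sum, ← sum_add_distrib]
  refine sum_le_sum fun h _ => ?_
  nlinarith [two_mul_le_add_sq #{x ∈ s | f x = h} #{y ∈ t | g y = h}]

open Finset in
/-- The solutions of `v x₁ + v x₂ + g w = v y₁ + v y₂ + g w'` with `x₁ ∈ A`, `x₂ ∈ B`,
`y₁ ∈ C`, `y₂ ∈ D` and `w, w' ∈ W`. -/
def pairSolutions {α τ G : Type*} [AddCommGroup G] [DecidableEq G] (v : α → G) (g : τ → G)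
    (W : Finset τ) (A B C D : Finset α) : Finset ((α × α × τ) × (α × α × τ)) :=
  {z ∈ (A ×ˢ B ×ˢ W) ×ˢ (C ×ˢ D ×ˢ W) |
    v z.1.1 + v z.1.2.1 + g z.1.2.2 = v z.2.1 + v z.2.2.1 + g z.2.2.2}

section pairSolutions

open Finset

variable {α τ G : Type*} [AddCommGroup G] [DecidableEq G] (v : α → G) (g : τ → G)
  (W : Finset τ) (A B C D : Finset α)

theorem two_mul_card_pairSolutions_le :
    2 * #(pairSolutions v g W A B C D) ≤
      #(pairSolutions v g W A B A B) + #(pairSolutions v g W C D C D) :=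
  two_mul_card_coincidences_le (A ×ˢ B ×ˢ W) (C ×ˢ D ×ˢ W)
    (fun x => v x.1 + v x.2.1 + g x.2.2) (fun x => v x.1 + v x.2.1 + g x.2.2)

theorem two_mul_card_pairSolutions_self_le :
    2 * #(pairSolutions v g W A B A B) ≤
      #(pairSolutions v g W A A A A) + #(pairSolutions v g W B B B B) := by
  have h := two_mul_card_coincidences_le (A ×ˢ A ×ˢ W) (B ×ˢ B ×ˢ W)
    (fun x => v x.1 - v x.2.1 + g x.2.2) (fun x => v x.2.1 - v x.1 + g x.2.2)
  have e₁ : #(pairSolutions v g W A B A B) =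
      #{z ∈ (A ×ˢ A ×ˢ W) ×ˢ (B ×ˢ B ×ˢ W) |
        v z.1.1 - v z.1.2.1 + g z.1.2.2 = v z.2.2.1 - v z.2.1 + g z.2.2.2} := by
    refine card_nbij' (fun z => ((z.1.1, z.2.1, z.1.2.2), (z.1.2.1, z.2.2.1, z.2.2.2)))
      (fun z => ((z.1.1, z.2.1, z.1.2.2), (z.1.2.1, z.2.2.1, z.2.2.2))) ?_ ?_ ?_ ?_
    iterate 2
      rintro ⟨⟨x, y, w⟩, x', y', w'⟩ hz
      simp only [pairSolutions, coe_filter, mem_product, Set.mem_ofPred_eq] at hz ⊢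
      refine ⟨by tauto, ?_⟩
      rw [← sub_eq_zero] at hz ⊢
      rw [← hz.2]; abel
    all_goals exact fun _ _ => rfl
  have e₂ : #(pairSolutions v g W A A A A) =
      #{z ∈ (A ×ˢ A ×ˢ W) ×ˢ (A ×ˢ A ×ˢ W) |
        v z.1.1 - v z.1.2.1 + g z.1.2.2 = v z.2.1 - v z.2.2.1 + g z.2.2.2} := by
    refine card_nbij' (fun z => ((z.1.1, z.2.2.1, z.1.2.2), (z.2.1, z.1.2.1, z.2.2.2)))
      (fun z => ((z.1.1, z.2.2.1, z.1.2.2), (z.2.1, z.1.2.1, z.2.2.2))) ?_ ?_ ?_ ?_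
    iterate 2
      rintro ⟨⟨x, y, w⟩, x', y', w'⟩ hz
      simp only [pairSolutions, coe_filter, mem_product, Set.mem_ofPred_eq] at hz ⊢
      refine ⟨by tauto, ?_⟩
      rw [← sub_eq_zero] at hz ⊢
      rw [← hz.2]; abel
    all_goals exact fun _ _ => rfl
  have e₃ : #(pairSolutions v g W B B B B) =
      #{z ∈ (B ×ˢ B ×ˢ W) ×ˢ (B ×ˢ B ×ˢ W) |
        v z.1.2.1 - v z.1.1 + g z.1.2.2 = v z.2.2.1 - v z.2.1 + g z.2.2.2} := by
    refine card_nbij' (fun z => ((z.2.1, z.1.2.1, z.1.2.2), (z.1.1, z.2.2.1, z.2.2.2)))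
      (fun z => ((z.2.1, z.1.2.1, z.1.2.2), (z.1.1, z.2.2.1, z.2.2.2))) ?_ ?_ ?_ ?_
    iterate 2
      rintro ⟨⟨x, y, w⟩, x', y', w'⟩ hz
      simp only [pairSolutions, coe_filter, mem_product, Set.mem_ofPred_eq] at hz ⊢
      refine ⟨by tauto, ?_⟩
      rw [← sub_eq_zero] at hz ⊢
      rw [← hz.2]; abel
    all_goals exact fun _ _ => rfl
  rw [e₁, e₂, e₃]
  exact h

theorem card_pairSolutions_le {M : ℕ} (hA : #(pairSolutions v g W A A A A) ≤ M)
    (hB : #(pairSolutions v g W B B B B) ≤ M) (hC : #(pairSolutions v g W C C C C) ≤ M)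
    (hD : #(pairSolutions v g W D D D D) ≤ M) : #(pairSolutions v g W A B C D) ≤ M := by
  have h₁ := two_mul_card_pairSolutions_le v g W A B C D
  have h₂ := two_mul_card_pairSolutions_self_le v g W A B
  have h₃ := two_mul_card_pairSolutions_self_le v g W C D
  omega

end pairSolutions

/-- The point `(x, x², x³)` of the twisted cubic. -/
def momentVec (x : ℕ) : ℤ × ℤ × ℤ := (x, x ^ 2, x ^ 3)

/-- The positive integers up to `n` that are congruent to `ξ` modulo `q`. -/
def residueFinset (n : ℕ) (q ξ : ℤ) : Finset ℕ := {x ∈ Finset.Icc 1 n | (x : ℤ) ≡ ξ [ZMOD q]}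

theorem mem_residueFinset {n : ℕ} {q ξ : ℤ} {x : ℕ} :
    x ∈ residueFinset n q ξ ↔ (1 ≤ x ∧ x ≤ n) ∧ (x : ℤ) ≡ ξ [ZMOD q] := by
  simp [residueFinset]

/-- The solutions of the cubic Vinogradov system in six variables on each side, up to `n`, with the
first two variables on the left in `A` and `B`, the first two on the right in `C` and `D`, and
all others congruent to `η` modulo `q`. -/
def vinogradovSolutions (n : ℕ) (q η : ℤ) (A B C D : Finset ℕ) :
    Finset ((ℕ × ℕ × (Fin 4 → ℕ)) × (ℕ × ℕ × (Fin 4 → ℕ))) :=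
  pairSolutions momentVec (fun w : Fin 4 → ℕ => ∑ i, momentVec (w i))
    (Fintype.piFinset fun _ => residueFinset n q η) A B C D

/-- Splitting off the first two coordinates of a 6-tuple. -/
def splitTwo : (Fin 6 → ℕ) ≃ ℕ × ℕ × (Fin 4 → ℕ) where
  toFun x := (x 0, x 1, fun i => x i.succ.succ)
  invFun z := Fin.cons z.1 (Fin.cons z.2.1 z.2.2)
  left_inv x := by
    ext i
    refine Fin.cases rfl (fun i => ?_) i
    exact Fin.cases rfl (fun i => rfl) i
  right_inv z := rfl

theorem splitTwo_apply (x : Fin 6 → ℕ) : splitTwo x = (x 0, x 1, fun i => x i.succ.succ) := rfl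

theorem Icount_two_eq (p : ℕ) {X : ℝ} (hX : 1 ≤ X) (a b : ℕ) (ξ η : ℤ) :
    Icount p X 2 a b ξ η = (vinogradovSolutions ⌊X⌋₊ ((p : ℤ) ^ b) η
      (residueFinset ⌊X⌋₊ ((p : ℤ) ^ a) ξ) (residueFinset ⌊X⌋₊ ((p : ℤ) ^ a) ξ)
      (residueFinset ⌊X⌋₊ ((p : ℤ) ^ a) ξ) (residueFinset ⌊X⌋₊ ((p : ℤ) ^ a) ξ)).card := by
  rw [← Finset.card_map (splitTwo.prodCongr splitTwo).symm.toEmbedding]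
  refine Nat.subtype_card _ fun ⟨x, y⟩ => ?_
  have hfl : ∀ k : ℕ, (k : ℝ) ≤ X ↔ k ≤ ⌊X⌋₊ := fun k => (Nat.le_floor_iff (by linarith)).symm
  have hsys : (∀ j ∈ Finset.Icc 1 3, ∑ i, x i ^ j = ∑ i, y i ^ j) ↔
      momentVec (x 0) + momentVec (x 1) + ∑ i : Fin 4, momentVec (x i.succ.succ) =
      momentVec (y 0) + momentVec (y 1) + ∑ i : Fin 4, momentVec (y i.succ.succ) := by
    have hI : Finset.Icc 1 3 = {1, 2, 3} := rfl
    have hj : ∀ j, (∑ i, x i ^ j = ∑ i, y i ^ j) ↔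
        (x 0 : ℤ) ^ j + (x 1 : ℤ) ^ j + ∑ i : Fin 4, (x i.succ.succ : ℤ) ^ j =
        (y 0 : ℤ) ^ j + (y 1 : ℤ) ^ j + ∑ i : Fin 4, (y i.succ.succ : ℤ) ^ j := by
      intro j
      rw [Fin.sum_univ_succ, Fin.sum_univ_succ, Fin.sum_univ_succ (f := fun i => y i ^ j),
        Fin.sum_univ_succ (n := 4) (f := fun i => y i.succ ^ j), ← add_assoc, ← add_assoc]
      exact_mod_cast Iff.rfl
    simp only [hI, Finset.mem_insert, Finset.mem_singleton, forall_eq_or_imp, forall_eq, hj,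
      momentVec, Prod.ext_iff, Prod.fst_add, Prod.snd_add, Prod.fst_sum, Prod.snd_sum, pow_one]
  have hcls : ∀ u : Fin 6 → ℕ,
      (u 0 ∈ residueFinset ⌊X⌋₊ ((p : ℤ) ^ a) ξ ∧ u 1 ∈ residueFinset ⌊X⌋₊ ((p : ℤ) ^ a) ξ ∧
        ∀ i : Fin 4, u i.succ.succ ∈ residueFinset ⌊X⌋₊ ((p : ℤ) ^ b) η) ↔
      (∀ i, 1 ≤ u i ∧ (u i : ℝ) ≤ X) ∧
      (∀ i : Fin 6, if (i : ℕ) < 2 then (u i : ℤ) ≡ ξ [ZMOD (p : ℤ) ^ a]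
        else (u i : ℤ) ≡ η [ZMOD (p : ℤ) ^ b]) := by
    intro u
    simp only [mem_residueFinset, hfl, Fin.forall_fin_succ (n := 5), Fin.forall_fin_succ (n := 4)]
    simp only [Fin.val_zero, Fin.val_succ, Fin.succ_zero_eq_one, forall_and]
    simp
    tauto
  rw [Finset.mem_map_equiv]
  simp only [vinogradovSolutions, pairSolutions, splitTwo_apply, Finset.mem_filter, Finset.mem_product,
    Fintype.mem_piFinset, Equiv.symm_symm, Equiv.prodCongr_apply, Prod.map, ← hsys, hcls]
  tauto

theorem bddAbove_Icount_two (p : ℕ) {X : ℝ} (hX : 1 ≤ X) (a b : ℕ) :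
    BddAbove {n : ℕ | ∃ ξ η : ℤ, ¬ ξ ≡ η [ZMOD (p : ℤ)] ∧ n = Icount p X 2 a b ξ η} := by
  let T := Finset.Icc 1 ⌊X⌋₊ ×ˢ Finset.Icc 1 ⌊X⌋₊ ×ˢ
    Fintype.piFinset fun _ : Fin 4 => Finset.Icc 1 ⌊X⌋₊
  refine ⟨(T ×ˢ T).card, ?_⟩
  rintro _ ⟨ξ, η, -, rfl⟩
  rw [Icount_two_eq p hX]
  have h : ∀ q ζ, residueFinset ⌊X⌋₊ q ζ ⊆ Finset.Icc 1 ⌊X⌋₊ := fun q ζ =>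
    Finset.filter_subset _ _
  have hT : residueFinset ⌊X⌋₊ ((p : ℤ) ^ a) ξ ×ˢ residueFinset ⌊X⌋₊ ((p : ℤ) ^ a) ξ ×ˢ
      (Fintype.piFinset fun _ : Fin 4 => residueFinset ⌊X⌋₊ ((p : ℤ) ^ b) η) ⊆ T :=
    Finset.product_subset_product (h _ _) (Finset.product_subset_product (h _ _)
      (Fintype.piFinset_subset _ _ fun _ => h _ _))
  exact Finset.card_le_card ((Finset.filter_subset _ _).trans
    (Finset.product_subset_product hT hT))

theorem Icount_two_le_Imax {p : ℕ} {X : ℝ} (hX : 1 ≤ X) (a b : ℕ) {ξ η : ℤ}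
    (h : ¬ ξ ≡ η [ZMOD (p : ℤ)]) : Icount p X 2 a b ξ η ≤ Imax p X 2 a b := by
  rw [Imax, if_neg two_ne_zero]
  exact le_csSup (bddAbove_Icount_two p hX a b) ⟨ξ, η, h, rfl⟩

/-- Four integers in a common nonzero class modulo `p` whose first two and last two have equal
sums of squares and of cubes modulo `p ^ n` form a degenerate parallelogram modulo `p ^ n`. -/
theorem dvd_of_sum_sq_of_sum_cube {p : ℕ} (hp : p.Prime) (hp5 : 5 ≤ p) {n : ℕ}
    {y₁ y₂ y₃ y₄ ν : ℤ} (hν : ¬ (p : ℤ) ∣ ν) (h₁ : (p : ℤ) ∣ y₁ - ν) (h₂ : (p : ℤ) ∣ y₂ - ν)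
    (h₃ : (p : ℤ) ∣ y₃ - ν) (h₄ : (p : ℤ) ∣ y₄ - ν)
    (hsq : (p : ℤ) ^ n ∣ y₁ ^ 2 + y₂ ^ 2 - y₃ ^ 2 - y₄ ^ 2)
    (hcu : (p : ℤ) ^ n ∣ y₁ ^ 3 + y₂ ^ 3 - y₃ ^ 3 - y₄ ^ 3) :
    (p : ℤ) ^ n ∣ (y₁ - y₃) * (y₂ - y₃) ∧ (p : ℤ) ^ n ∣ y₄ - (y₁ + y₂ - y₃) := by
  have hpZ : Prime (p : ℤ) := Nat.prime_iff_prime_int.mp hp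
  have hp2 : ¬ (p : ℤ) ∣ 2 := fun h => by have := Int.le_of_dvd (by norm_num) h; omega
  have hp3 : ¬ (p : ℤ) ∣ 3 := fun h => by have := Int.le_of_dvd (by norm_num) h; omega
  have hcop : ∀ {e : ℤ}, ¬ (p : ℤ) ∣ e → IsCoprime ((p : ℤ) ^ n) e := fun h =>
    ((hpZ.coprime_iff_not_dvd).2 h).pow_left
  obtain ⟨t₁, e₁⟩ := h₁
  obtain ⟨t₂, e₂⟩ := h₂
  obtain ⟨t₃, e₃⟩ := h₃
  obtain ⟨t₄, e₄⟩ := h₄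
  have hy₁ : ν + p * t₁ = y₁ := by linarith
  have hy₂ : ν + p * t₂ = y₂ := by linarith
  have hy₃ : ν + p * t₃ = y₃ := by linarith
  have hy₄ : ν + p * t₄ = y₄ := by linarith
  set s := y₁ + y₂ - y₃ with hs
  set d := y₄ - s with hd
  have hu : ¬ (p : ℤ) ∣ 2 * s + d := by
    intro h
    have : (p : ℤ) ∣ 2 * ν := by
      have e : 2 * ν = (2 * s + d) - p * (t₁ + t₂ - t₃ + t₄) := by
        rw [hd, hs, ← hy₁, ← hy₂, ← hy₃, ← hy₄]; ring
      rw [e]; exact dvd_sub h (dvd_mul_right _ _)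
    exact (hpZ.dvd_or_dvd this).elim hp2 hν
  have hprod : (p : ℤ) ^ n ∣ (y₁ - y₃) * (y₂ - y₃) := by
    have hm : (p : ℤ) ^ n ∣ (2 * (3 * s ^ 2 + 3 * s * d + d ^ 2) - 3 * (y₁ + y₂) * (2 * s + d)) *
        ((y₁ - y₃) * (y₂ - y₃)) := by
      have := dvd_sub (hcu.mul_left (2 * s + d)) (hsq.mul_left (3 * s ^ 2 + 3 * s * d + d ^ 2))
      refine this.trans (dvd_of_eq ?_)
      rw [hd, hs]; ring
    refine (hcop ?_).dvd_of_dvd_mul_left hm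
    intro h
    have : (p : ℤ) ∣ 2 * (3 * (ν * ν)) := by
      have e : ((2 * (3 * s ^ 2 + 3 * s * d + d ^ 2) - 3 * (y₁ + y₂) * (2 * s + d)) : ℤ) ≡
          -(2 * (3 * (ν * ν))) [ZMOD p] := by
        have c : ∀ t : ℤ, ν + p * t ≡ ν [ZMOD p] := fun t => by simp
        have cs : s ≡ ν [ZMOD p] := by
          have := ((c t₁).add (c t₂)).sub (c t₃)
          rw [hy₁, hy₂, hy₃] at this
          simpa using this
        have cd : d ≡ 0 [ZMOD p] := by
          have := (c t₄).sub cs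
          rw [hy₄] at this
          simpa using this
        have c12 : y₁ + y₂ ≡ ν + ν [ZMOD p] := hy₁ ▸ hy₂ ▸ (c t₁).add (c t₂)
        have := (((((cs.pow 2).mul_left 3).add ((cs.mul_left 3).mul cd)).add
          (cd.pow 2)).mul_left 2).sub ((c12.mul_left 3).mul ((cs.mul_left 2).add cd))
        refine this.trans (congrArg (· % _) ?_)
        ring
      rw [← dvd_neg]
      exact e.dvd_iff.1 h
    rcases hpZ.dvd_or_dvd this with h | h
    · exact hp2 h
    rcases hpZ.dvd_or_dvd h with h | h
    · exact hp3 h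
    exact hν ((hpZ.dvd_or_dvd h).elim id id)
  refine ⟨hprod, (hcop hu).dvd_of_dvd_mul_left (?_ : _ ∣ (2 * s + d) * d)⟩
  have := dvd_sub (hprod.mul_left (-2)) hsq
  refine this.trans (dvd_of_eq ?_)
  rw [hd, hs]; ring

theorem exists_pow_dvd_and_pow_dvd_of_pow_dvd_mul {p : ℕ} (hp : p.Prime) {c : ℕ} {h k : ℤ}
    (hd : (p : ℤ) ^ c ∣ h * k) : ∃ i ≤ c, (p : ℤ) ^ i ∣ h ∧ (p : ℤ) ^ (c - i) ∣ k := by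
  have : p ^ c ∣ h.natAbs * k.natAbs := by
    rw [← Int.natAbs_mul]; exact Int.natCast_dvd.1 (by exact_mod_cast hd)
  obtain ⟨d, e, hdh, hek, hde⟩ := (Nat.dvd_mul).1 this
  obtain ⟨i, hi, rfl⟩ := (Nat.dvd_prime_pow hp).1 (Dvd.intro _ hde)
  refine ⟨i, hi, by exact_mod_cast Int.natCast_dvd.2 hdh, ?_⟩
  have : e = p ^ (c - i) := by
    apply Nat.eq_of_mul_eq_mul_left (pow_pos hp.pos i)
    rw [hde, ← pow_add, Nat.add_sub_cancel' hi]
  rw [this] at hek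
  exact_mod_cast Int.natCast_dvd.2 hek

theorem exists_natCast_modEq (m : ℤ) {q : ℕ} (hq : 0 < q) :
    ∃ r ∈ Finset.range q, m ≡ r [ZMOD q] := by
  have hq' : (0 : ℤ) < q := by exact_mod_cast hq
  refine ⟨(m % q).toNat, ?_, ?_⟩
  · have := Int.emod_lt_of_pos m hq'
    have := Int.emod_nonneg m hq'.ne'
    simp only [Finset.mem_range]; omega
  · rw [Int.toNat_of_nonneg (Int.emod_nonneg m hq'.ne')]
    exact (Int.mod_modEq m q).symm

/-- Each solution is a degenerate parallelogram in its first two variables on each side. -/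
theorem dvd_of_mem_vinogradovSolutions {p : ℕ} (hp : p.Prime) (hp5 : 5 ≤ p) {n a b : ℕ}
    (ha : 1 ≤ a) {ξ η : ℤ} (hξη : ¬ ξ ≡ η [ZMOD (p : ℤ)]) {x₁ x₂ y₁ y₂ : ℕ} {w w' : Fin 4 → ℕ}
    (hz : ((x₁, x₂, w), (y₁, y₂, w')) ∈ vinogradovSolutions n ((p : ℤ) ^ b) η
      (residueFinset n ((p : ℤ) ^ a) ξ) (residueFinset n ((p : ℤ) ^ a) ξ)
      (residueFinset n ((p : ℤ) ^ a) ξ) (residueFinset n ((p : ℤ) ^ a) ξ)) :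
    (p : ℤ) ^ (2 * b) ∣ ((x₁ : ℤ) - y₁) * (x₂ - y₁) ∧
      (p : ℤ) ^ (2 * b) ∣ (y₂ : ℤ) - (x₁ + x₂ - y₁) := by
  simp only [vinogradovSolutions, pairSolutions, Finset.mem_filter, Finset.mem_product,
    Fintype.mem_piFinset, mem_residueFinset, momentVec, Prod.ext_iff, Prod.fst_add, Prod.snd_add,
    Prod.fst_sum, Prod.snd_sum] at hz
  obtain ⟨⟨⟨hx₁, hx₂, hw⟩, hy₁, hy₂, hw'⟩, s₁, s₂, s₃⟩ := hz
  have hcl : ∀ {x : ℕ}, (x : ℤ) ≡ ξ [ZMOD (p : ℤ) ^ a] → (p : ℤ) ∣ (x - η) - (ξ - η) := by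
    intro x hx
    have : (p : ℤ) ∣ x - ξ := (dvd_pow_self _ (by omega)).trans hx.symm.dvd
    convert this using 1; ring
  have hpw : ∀ {x : ℕ} {j : ℕ}, 2 ≤ j → (x : ℤ) ≡ η [ZMOD (p : ℤ) ^ b] →
      (p : ℤ) ^ (2 * b) ∣ (x - η) ^ j := by
    intro x j hj hx
    refine (?_ : _ ∣ ((x : ℤ) - η) ^ 2).trans (pow_dvd_pow _ hj)
    rw [mul_comm, pow_mul]
    exact pow_dvd_pow_of_dvd hx.symm.dvd 2
  have hsum : ∀ {j : ℕ}, 2 ≤ j → (p : ℤ) ^ (2 * b) ∣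
      ∑ i, ((w' i : ℤ) - η) ^ j - ∑ i, ((w i : ℤ) - η) ^ j := fun hj =>
    dvd_sub (Finset.dvd_sum fun i _ => hpw hj (hw' i).2)
      (Finset.dvd_sum fun i _ => hpw hj (hw i).2)
  have key := dvd_of_sum_sq_of_sum_cube hp hp5 (n := 2 * b) (ν := ξ - η)
    (fun h => hξη (Int.modEq_iff_dvd.2 h).symm) (hcl hx₁.2) (hcl hx₂.2) (hcl hy₁.2) (hcl hy₂.2)
    ((hsum (j := 2) le_rfl).trans (dvd_of_eq ?_))
    ((hsum (j := 3) (by norm_num)).trans (dvd_of_eq ?_))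
  · refine ⟨?_, ?_⟩
    · convert key.1 using 1; ring
    · convert key.2 using 1; ring
  · simp only [Fin.sum_univ_four] at s₁ s₂ s₃ ⊢
    linear_combination -s₂ + 2 * η * s₁
  · simp only [Fin.sum_univ_four] at s₁ s₂ s₃ ⊢
    linear_combination -s₃ + 3 * η * s₂ - 3 * η ^ 2 * s₁

theorem Icount_two_le {p : ℕ} (hp : p.Prime) (hp5 : 5 ≤ p) {a b : ℕ} (ha : 1 ≤ a) (hab : a ≤ b)
    {X : ℝ} (hX : 1 ≤ X) {ξ η : ℤ} (hξη : ¬ ξ ≡ η [ZMOD (p : ℤ)]) :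
    Icount p X 2 a b ξ η ≤
      (2 * (b - a) + 1) * p ^ (4 * (b - a)) * Imax p X 2 (2 * b - a) b := by
  obtain ⟨e, rfl⟩ := Nat.exists_eq_add_of_le hab
  set c := 2 * e with hc
  have hexp : 2 * (a + e) - a = a + c := by omega
  rw [hexp, Icount_two_eq p hX, Nat.add_sub_cancel_left, ← hc]
  let index : Finset (Σ _ : ℕ, ℕ × ℕ × ℕ) := (Finset.range (c + 1)).sigma fun i =>
    Finset.range (p ^ c) ×ˢ Finset.range (p ^ (c - i)) ×ˢ Finset.range (p ^ i)
  let R : ℤ → Finset ℕ := fun m => residueFinset ⌊X⌋₊ ((p : ℤ) ^ (a + c)) (ξ + (p : ℤ) ^ a * m)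
  let sol : (Σ _ : ℕ, ℕ × ℕ × ℕ) → Finset ((ℕ × ℕ × (Fin 4 → ℕ)) × (ℕ × ℕ × (Fin 4 → ℕ))) :=
    fun ⟨i, r, h, k⟩ => vinogradovSolutions ⌊X⌋₊ ((p : ℤ) ^ (a + e)) η
      (R (r + p ^ i * h)) (R (r + p ^ (c - i) * k)) (R r) (R (r + p ^ i * h + p ^ (c - i) * k))
  have hindex : index.card = (c + 1) * p ^ (4 * e) := by
    have : ∀ i ∈ Finset.range (c + 1), (Finset.range (p ^ c) ×ˢ Finset.range (p ^ (c - i)) ×ˢ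
        Finset.range (p ^ i)).card = p ^ (4 * e) := by
      intro i hi
      have hi : i ≤ c := by simpa [Nat.lt_succ_iff] using hi
      simp only [Finset.card_product, Finset.card_range, ← pow_add]
      congr 1; omega
    rw [Finset.card_sigma, Finset.sum_congr rfl this]
    simp
  have hR : ∀ m : ℤ, (vinogradovSolutions ⌊X⌋₊ ((p : ℤ) ^ (a + e)) η
      (R m) (R m) (R m) (R m)).card ≤ Imax p X 2 (a + c) (a + e) := by
    intro m
    rw [← Icount_two_eq p hX]
    refine Icount_two_le_Imax hX _ _ fun h => hξη (Int.ModEq.trans ?_ h)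
    exact Int.modEq_iff_dvd.2 (by
      rw [add_sub_cancel_left]
      exact (dvd_pow_self _ (by omega)).mul_right _)
  rw [← hindex]
  refine (Finset.card_le_card (t := index.biUnion sol) ?_).trans
    (Finset.card_biUnion_le_card_mul _ _ _ ?_)
  · rintro ⟨⟨x₁, x₂, w⟩, y₁, y₂, w'⟩ hz
    obtain ⟨hprod, hpar⟩ := dvd_of_mem_vinogradovSolutions hp hp5 ha hξη hz
    simp only [vinogradovSolutions, pairSolutions, Finset.mem_filter, Finset.mem_product,
      mem_residueFinset] at hz
    obtain ⟨⟨⟨⟨rx₁, hx₁⟩, ⟨rx₂, hx₂⟩, hw⟩, ⟨ry₁, hy₁⟩, ⟨ry₂, hy₂⟩, hw'⟩, hsys⟩ := hz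
    obtain ⟨r₀, er⟩ := hy₁.symm.dvd
    obtain ⟨h₀, eh⟩ := (hx₁.trans hy₁.symm).symm.dvd
    obtain ⟨k₀, ek⟩ := (hx₂.trans hy₁.symm).symm.dvd
    have hpa : (p : ℤ) ^ (2 * a) ≠ 0 := pow_ne_zero _ (by exact_mod_cast hp.ne_zero)
    have hhk : (p : ℤ) ^ c ∣ h₀ * k₀ := by
      rw [← mul_dvd_mul_iff_left hpa, ← pow_add]
      rw [eh, ek] at hprod
      rw [show 2 * a + c = 2 * (a + e) by omega]
      exact hprod.trans (dvd_of_eq (by ring))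
    obtain ⟨i, hi, ⟨h₁, rfl⟩, ⟨k₁, rfl⟩⟩ := exists_pow_dvd_and_pow_dvd_of_pow_dvd_mul hp hhk
    obtain ⟨r, hr, r_mod⟩ := exists_natCast_modEq r₀ (pow_pos hp.pos c)
    obtain ⟨h, hh, h_mod⟩ := exists_natCast_modEq h₁ (pow_pos hp.pos (c - i))
    obtain ⟨k, hk, k_mod⟩ := exists_natCast_modEq k₁ (pow_pos hp.pos i)
    push_cast at r_mod h_mod k_mod
    have ph : (p : ℤ) ^ i * h₁ ≡ p ^ i * h [ZMOD (p : ℤ) ^ c] := by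
      have := h_mod.mul_left' (c := (p : ℤ) ^ i)
      rwa [← pow_add, Nat.add_sub_cancel' hi] at this
    have pk : (p : ℤ) ^ (c - i) * k₁ ≡ p ^ (c - i) * k [ZMOD (p : ℤ) ^ c] := by
      have := k_mod.mul_left' (c := (p : ℤ) ^ (c - i))
      rwa [← pow_add, Nat.sub_add_cancel hi] at this
    have lift : ∀ {m m' : ℤ}, m ≡ m' [ZMOD (p : ℤ) ^ c] →
        ξ + (p : ℤ) ^ a * m ≡ ξ + (p : ℤ) ^ a * m' [ZMOD (p : ℤ) ^ (a + c)] := by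
      intro m m' hm
      rw [pow_add]
      exact hm.mul_left'.add_left ξ
    refine Finset.mem_biUnion.2 ⟨⟨i, r, h, k⟩, ?_, ?_⟩
    · simp only [index, Finset.mem_sigma, Finset.mem_product]
      exact ⟨Finset.mem_range.2 (by omega), hr, hh, hk⟩
    · simp only [sol, R, vinogradovSolutions, pairSolutions, Finset.mem_filter,
        Finset.mem_product, mem_residueFinset]
      refine ⟨⟨⟨⟨rx₁, ?_⟩, ⟨rx₂, ?_⟩, hw⟩, ⟨ry₁, ?_⟩, ⟨ry₂, ?_⟩, hw'⟩, hsys⟩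
      · refine Int.ModEq.trans (congrArg (· % _) ?_) (lift (r_mod.add ph))
        linear_combination er + eh
      · refine Int.ModEq.trans (congrArg (· % _) ?_) (lift (r_mod.add pk))
        linear_combination er + ek
      · refine Int.ModEq.trans (congrArg (· % _) ?_) (lift r_mod)
        linear_combination er
      · have hy : (y₂ : ℤ) ≡ x₁ + x₂ - y₁ [ZMOD (p : ℤ) ^ (a + c)] :=
          (Int.modEq_iff_dvd.2 ((pow_dvd_pow _ (by omega)).trans hpar)).symm
        refine (hy.trans (congrArg (· % _) ?_)).trans (lift ((r_mod.add ph).add pk))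
        linear_combination er + eh + ek
  · rintro ⟨i, r, h, k⟩ -
    exact card_pairSolutions_le _ _ _ _ _ _ _ (hR _) (hR _) (hR _) (hR _)

/-- Lemma 6: if `1 ≤ a ≤ b` then `I₂(X;a,b) ≤ 2b · p^(4(b−a)) · I₂(X;2b−a,b)`. -/
theorem I2_raise (p : ℕ) (hp : p.Prime) (hp5 : 5 ≤ p) (a b : ℕ) (ha : 1 ≤ a) (hab : a ≤ b)
    (X : ℝ) (hX : 1 ≤ X) :
    Imax p X 2 a b ≤ 2 * b * p ^ (4 * (b - a)) * Imax p X 2 (2 * b - a) b := by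
  refine le_trans (b := (2 * (b - a) + 1) * p ^ (4 * (b - a)) * Imax p X 2 (2 * b - a) b) ?_ ?_
  · conv_lhs => rw [Imax, if_neg two_ne_zero]
    refine csSup_le' ?_
    rintro _ ⟨ξ, η, hξη, rfl⟩
    exact Icount_two_le hp hp5 ha hab hX hξη
  · gcongr
    omega
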